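/- In the Baumslag–Solitar group BS(1,2) = ⟨a,b | bab⁻¹ = a²⟩, the set Λ := ⟨a⟩ ∪ {b, b⁻¹} satisfies Λ² ⊆ Λ · {e, b, b⁻¹, b⁻¹a}; in particular Λ is an approximate subgroup of BS(1,2). -/

import Mathlib

open Pointwise

/-- The relator of the Baumslag–Solitar group `BS(1,2) = ⟨a,b ∣ b a b⁻¹ = a²⟩`,
with `a = of 0`, `b = of 1`. -/
def bs12Rels : Set (FreeGroup (Fin 2)) :=
  {FreeGroup.of 1 * FreeGroup.of 0 * (FreeGroup.of 1)⁻¹ * ((FreeGroup.of 0) ^ 2)⁻¹}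

/-- The Baumslag–Solitar group `BS(1,2)`. -/
abbrev BS12 := PresentedGroup bs12Rels

theorem bs12_cover {G : Type*} [Group G] (a b : G) (h : b * a * b⁻¹ = a ^ 2) :
    ((Subgroup.zpowers a : Set G) ∪ {b, b⁻¹}) * ((Subgroup.zpowers a : Set G) ∪ {b, b⁻¹}) ⊆
      ((Subgroup.zpowers a : Set G) ∪ {b, b⁻¹}) * ({1, b, b⁻¹, b⁻¹ * a} : Set G) := by
  have hb : ∀ n : ℤ, b * a ^ n = a ^ (2 * n) * b := by
    intro n
    have h1 : (b * a * b⁻¹) ^ n = b * a ^ n * b⁻¹ := conj_zpow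
    rw [h, ← zpow_natCast, ← zpow_mul] at h1
    push_cast at h1
    rw [h1]; group
  have hb' : ∀ n : ℤ, b⁻¹ * a ^ (2 * n) = a ^ n * b⁻¹ := by
    intro n
    rw [inv_mul_eq_iff_eq_mul, ← mul_assoc, hb n, mul_inv_cancel_right]
  rintro _ ⟨x, hx, y, hy, rfl⟩
  have hz : ∀ n : ℤ, a ^ n ∈ ((Subgroup.zpowers a : Set G) ∪ {b, b⁻¹}) :=
    fun n => Or.inl ⟨n, rfl⟩
  have h1 : (1 : G) ∈ ((Subgroup.zpowers a : Set G) ∪ {b, b⁻¹}) := by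
    simpa using hz 0
  rcases hy with ⟨m, rfl⟩ | hy
  · rcases hx with ⟨n, rfl⟩ | rfl | rfl
    · exact ⟨a ^ (n + m), hz _, 1, by simp, by simp [zpow_add]⟩
    · exact ⟨a ^ (2 * m), hz _, x, by simp, (hb m).symm⟩
    · rcases Int.even_or_odd' m with ⟨k, rfl | rfl⟩
      · exact ⟨a ^ k, hz _, b⁻¹, by simp, (hb' k).symm⟩
      · refine ⟨a ^ k, hz _, b⁻¹ * a, by simp, ?_⟩
        change a ^ k * (b⁻¹ * a) = b⁻¹ * a ^ (2 * k + 1)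
        rw [zpow_add, ← mul_assoc, ← mul_assoc, hb' k, zpow_one]
  · refine ⟨x, hx, y, ?_, rfl⟩
    rcases hy with rfl | rfl <;> simp

/-- In `BS(1,2)`, the set `Λ = ⟨a⟩ ∪ {b, b⁻¹}` satisfies `Λ² ⊆ Λ·{e, b, b⁻¹, b⁻¹a}`;
in particular `Λ` is an approximate subgroup of `BS(1,2)`. -/
theorem bs12_approx :
    let a : BS12 := PresentedGroup.of 0
    let b : BS12 := PresentedGroup.of 1
    let L : Set BS12 := (Subgroup.zpowers a : Set BS12) ∪ {b, b⁻¹}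
    L * L ⊆ L * ({1, b, b⁻¹, b⁻¹ * a} : Set BS12) ∧
    L⁻¹ = L ∧ (1 : BS12) ∈ L ∧
    ∃ F : Set BS12, F.Finite ∧ L * L ⊆ L * F := by
  intro a b L
  have h : b * a * b⁻¹ = a ^ 2 := by
    have := PresentedGroup.one_of_mem (rels := bs12Rels) (Set.mem_singleton _)
    rw [map_mul, map_inv, mul_inv_eq_one] at this
    simp only [map_mul, map_inv, map_pow] at this
    exact this
  refine ⟨bs12_cover a b h, ?_, Or.inl (one_mem _), _, ?_, bs12_cover a b h⟩
  · ext x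
    simp only [L, Set.mem_inv, Set.mem_union, SetLike.mem_coe, inv_mem_iff,
      Set.mem_insert_iff, Set.mem_singleton_iff, inv_inv, inv_eq_iff_eq_inv]
    tauto
  · exact Set.toFinite _
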